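/- Let A be a noetherian ring, I an ideal of A, and assume A is I-adically complete. Let A⟨T₁,…,T_m⟩ denote the I-adic completion of the polynomial ring A[T₁,…,T_m]. Let g₁,…,g_m and h₁,…,h_m be elements of A[T₁,…,T_m] with gᵢ − hᵢ ∈ I·A⟨T₁,…,T_m⟩ for every i, and put B = A⟨T₁,…,T_m⟩/(g₁,…,g_m) and B′ = A⟨T₁,…,T_m⟩/(h₁,…,h_m). If the image in B of the Jacobian determinant Δ = det(∂gᵢ/∂Tⱼ) is invertible, then B and B′ are isomorphic as A-algebras. -/

import Mathlib

open MvPolynomial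

/-- `A⟨T₁,…,T_m⟩`: the `I`-adic completion of the polynomial ring `A[T₁,…,T_m]`,
i.e. the completion with respect to the ideal generated by `I`. -/
noncomputable abbrev RestrictedPowerSeries (A : Type*) [CommRing A] (I : Ideal A) (m : ℕ) :=
  AdicCompletion (I.map (algebraMap A (MvPolynomial (Fin m) A))) (MvPolynomial (Fin m) A)

/-- The canonical ring homomorphism `A[T₁,…,T_m] → A⟨T₁,…,T_m⟩`. -/
noncomputable abbrev RestrictedPowerSeries.of (A : Type*) [CommRing A] (I : Ideal A) (m : ℕ) :
    MvPolynomial (Fin m) A →+* RestrictedPowerSeries A I m :=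
  algebraMap _ _

/-- The Jacobian determinant `det (∂gᵢ/∂Tⱼ)` of a family of `m` polynomials in `m` variables. -/
noncomputable abbrev jacobianDet {A : Type*} [CommRing A] {m : ℕ}
    (g : Fin m → MvPolynomial (Fin m) A) : MvPolynomial (Fin m) A :=
  Matrix.det (Matrix.of fun i j : Fin m => pderiv j (g i))

/-- Polynomial evaluation preserves congruences modulo an ideal. -/
theorem MvPolynomial.aeval_sub_aeval_mem {A S σ : Type*} [CommRing A] [CommRing S] [Algebra A S]
    (N : Ideal S) {s t : σ → S} (hst : ∀ i, s i - t i ∈ N) (p : MvPolynomial σ A) :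
    aeval s p - aeval t p ∈ N := by
  rw [← Ideal.Quotient.mk_eq_mk_iff_sub_mem]
  have : (Ideal.Quotient.mkₐ A N).comp (aeval s) = (Ideal.Quotient.mkₐ A N).comp (aeval t) := by
    ext i
    simpa using (Ideal.Quotient.mk_eq_mk_iff_sub_mem _ _).2 (hst i)
  exact DFunLike.congr_fun this p

/-- First order Taylor expansion of a multivariate polynomial. -/
theorem MvPolynomial.aeval_add_sub_linear_mem {A S σ : Type*} [CommRing A] [CommRing S]
    [Algebra A S] [Fintype σ] (N : Ideal S) (t : σ → S) {δ : σ → S} (hδ : ∀ i, δ i ∈ N)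
    (p : MvPolynomial σ A) :
    aeval (t + δ) p - aeval t p - ∑ j, aeval t (pderiv j p) * δ j ∈ N ^ 2 := by
  classical
  have hlin (q : MvPolynomial σ A) : ∑ j, aeval t (pderiv j q) * δ j ∈ N :=
    sum_mem fun j _ => N.mul_mem_left _ (hδ j)
  induction p using MvPolynomial.induction_on with
  | C a => simp
  | add p q hp hq =>
    convert add_mem hp hq using 1
    simp only [map_add, add_mul, Finset.sum_add_distrib]
    ring
  | mul_X p i hp =>
    have hX : ∑ j, aeval t (pderiv j (p * X i)) * δ j =
        aeval t p * δ i + t i * ∑ j, aeval t (pderiv j p) * δ j := by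
      simp only [pderiv_mul, pderiv_X, map_add, map_mul, aeval_X, add_mul, Finset.sum_add_distrib,
        Finset.mul_sum]
      rw [add_comm]
      congr 1
      · rw [Finset.sum_eq_single i]
        · simp
        · intro j _ hj
          simp [hj.symm]
        · simp
      · exact Finset.sum_congr rfl fun j _ => by ring
    have hmul : (∑ j, aeval t (pderiv j p) * δ j) * δ i ∈ N ^ 2 := by
      rw [pow_two]
      exact Ideal.mul_mem_mul (hlin p) (hδ i)
    convert add_mem (Ideal.mul_mem_right (t i + δ i) _ hp) hmul using 1
    rw [hX]
    simp only [map_mul, aeval_X, Pi.add_apply]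
    ring

/-- If `M` is an invertible matrix and all the entries of `M v` lie in an ideal, then so do
the entries of `v`. -/
theorem Matrix.mem_of_mulVec_mem {S σ : Type*} [CommRing S] [Fintype σ] [DecidableEq σ]
    {M : Matrix σ σ S} (hM : IsUnit M.det) (N : Ideal S) {v : σ → S}
    (hv : ∀ i, M.mulVec v i ∈ N) (i : σ) : v i ∈ N := by
  have : v = M⁻¹.mulVec (M.mulVec v) := by
    rw [Matrix.mulVec_mulVec, Matrix.nonsing_inv_mul _ hM, Matrix.one_mulVec]
  rw [this]
  exact sum_mem fun j _ => N.mul_mem_left _ (hv j)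

theorem IsAdicComplete.isUnit_of_sub_mem {S : Type*} [CommRing S] (N : Ideal S)
    [IsAdicComplete N S] {a b : S} (ha : IsUnit a) (hab : b - a ∈ N) : IsUnit b := by
  obtain ⟨c, hc⟩ := ha.exists_right_inv
  have h := Ideal.mem_jacobson_bot.1 (IsAdicComplete.le_jacobson_bot N hab) c
  have : (b - a) * c + 1 = b * c := by linear_combination -hc
  rw [this] at h
  exact isUnit_of_mul_isUnit_left h

theorem IsHausdorff.eq_of_sub_mem_pow {S : Type*} [CommRing S] (N : Ideal S) [IsHausdorff N S]
    {x y : S} (h : ∀ n, x - y ∈ N ^ n) : x = y := by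
  rw [IsHausdorff.eq_iff_smodEq (I := N)]
  intro n
  rw [SModEq.sub_mem]
  simpa using h n

section Newton

variable {A S : Type*} [CommRing A] [CommRing S] [Algebra A S] {m : ℕ}
  (N : Ideal S) (g : Fin m → MvPolynomial (Fin m) A)

theorem jacobianDet_aeval_eq_det (t : Fin m → S) :
    aeval t (jacobianDet g) = (Matrix.of fun i j => aeval t (pderiv j (g i))).det := by
  rw [jacobianDet, AlgHom.map_det]
  rfl

/-- One step of Newton's method. -/
theorem exists_newton_step {t : Fin m → S} (hΔ : IsUnit (aeval t (jacobianDet g)))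
    (hg : ∀ i, aeval t (g i) ∈ N) :
    ∃ t' : Fin m → S, (∀ i, t' i - t i ∈ N) ∧ ∀ i, aeval t' (g i) ∈ N ^ 2 := by
  rw [jacobianDet_aeval_eq_det] at hΔ
  set M := Matrix.of fun i j => aeval t (pderiv j (g i))
  let δ : Fin m → S := -(M⁻¹.mulVec fun i => aeval t (g i))
  have hMδ : M.mulVec δ = -fun i => aeval t (g i) := by
    rw [Matrix.mulVec_neg, Matrix.mulVec_mulVec, Matrix.mul_nonsing_inv _ hΔ, Matrix.one_mulVec]
  have hδ : ∀ i, δ i ∈ N := Matrix.mem_of_mulVec_mem hΔ N fun i => by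
    rw [hMδ]
    exact neg_mem (hg i)
  refine ⟨t + δ, fun i => by simpa using hδ i, fun i => ?_⟩
  convert aeval_add_sub_linear_mem N t hδ (g i) using 1
  have : ∑ j, aeval t (pderiv j (g i)) * δ j = -aeval t (g i) := congrFun hMδ i
  rw [this]
  ring

/-- **Hensel's lemma** in several variables, existence part. -/
theorem exists_aeval_eq_zero_of_isUnit_jacobianDet [IsAdicComplete N S] {t : Fin m → S}
    (hΔ : IsUnit (aeval t (jacobianDet g))) (hg : ∀ i, aeval t (g i) ∈ N) :
    ∃ t' : Fin m → S, (∀ i, t' i - t i ∈ N) ∧ ∀ i, aeval t' (g i) = 0 := by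
  have step (n : ℕ) (u : Fin m → S)
      (hu : (∀ i, u i - t i ∈ N) ∧ ∀ i, aeval u (g i) ∈ N ^ (n + 1)) :
      ∃ u' : Fin m → S, ((∀ i, u' i - t i ∈ N) ∧ ∀ i, aeval u' (g i) ∈ N ^ (n + 1 + 1)) ∧
        ∀ i, u' i - u i ∈ N ^ (n + 1) := by
    obtain ⟨u', h₁, h₂⟩ := exists_newton_step (N ^ (n + 1)) g
      (IsAdicComplete.isUnit_of_sub_mem N hΔ (aeval_sub_aeval_mem N hu.1 _)) hu.2
    refine ⟨u', ⟨fun i => ?_, fun i => ?_⟩, h₁⟩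
    · rw [← sub_add_sub_cancel _ (u i)]
      exact add_mem (Ideal.pow_le_self n.succ_ne_zero (h₁ i)) (hu.1 i)
    · rw [← pow_mul] at h₂
      exact Ideal.pow_le_pow_right (by lia) (h₂ i)
  choose! s hs hs' using step
  let u : ℕ → Fin m → S := fun n => Nat.rec t (fun n v => s n v) n
  have hu (n : ℕ) : (∀ i, u n i - t i ∈ N) ∧ ∀ i, aeval (u n) (g i) ∈ N ^ (n + 1) := by
    induction n with
    | zero => exact ⟨fun i => by simp [u], by simpa [u] using hg⟩
    | succ n ih => exact hs n (u n) ih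
  have hcauchy (i : Fin m) {a b : ℕ} (hab : a ≤ b) : u b i - u a i ∈ N ^ a := by
    induction b, hab using Nat.le_induction with
    | base => simp
    | succ b hab ih =>
      rw [← sub_add_sub_cancel _ (u b i)]
      exact add_mem (Ideal.pow_le_pow_right (by lia) (hs' b (u b) (hu b) i)) ih
  have hlim (i : Fin m) : ∃ L : S, ∀ n, L - u n i ∈ N ^ n := by
    obtain ⟨L, hL⟩ := IsPrecomplete.prec (I := N) inferInstance
      (f := fun n => u n i) (fun {a b} hab => by
        rw [SModEq.comm, SModEq.sub_mem]
        simpa using hcauchy i hab)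
    refine ⟨L, fun n => ?_⟩
    have := (hL n).symm
    rw [SModEq.sub_mem] at this
    simpa using this
  choose L hL using hlim
  refine ⟨L, fun i => ?_, fun i => IsHausdorff.eq_of_sub_mem_pow N fun n => ?_⟩
  · rw [← sub_add_sub_cancel _ (u 1 i)]
    exact add_mem (by simpa using hL i 1) ((hu 1).1 i)
  · rw [sub_zero, ← sub_add_cancel (aeval L (g i)) (aeval (u n) (g i))]
    exact add_mem (aeval_sub_aeval_mem _ (fun i => hL i n) _)
      (Ideal.pow_le_pow_right n.le_succ ((hu n).2 i))

/-- **Hensel's lemma** in several variables, uniqueness part. -/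
theorem eq_of_aeval_eq_zero_of_isUnit_jacobianDet [IsHausdorff N S] {t t' : Fin m → S}
    (hΔ : IsUnit (aeval t (jacobianDet g))) (ht : ∀ i, aeval t (g i) = 0)
    (ht' : ∀ i, aeval t' (g i) = 0) (htt' : ∀ i, t' i - t i ∈ N) : t' = t := by
  rw [jacobianDet_aeval_eq_det] at hΔ
  have key (n : ℕ) : ∀ i, (t' - t) i ∈ N ^ (n + 1) := by
    induction n with
    | zero => simpa using htt'
    | succ n ih =>
      refine Matrix.mem_of_mulVec_mem hΔ _ fun i => ?_
      have h := aeval_add_sub_linear_mem _ t ih (g i)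
      rw [add_sub_cancel, ht, ht', sub_zero, zero_sub, neg_mem_iff, ← pow_mul] at h
      exact Ideal.pow_le_pow_right (by lia) h
  exact funext fun i => IsHausdorff.eq_of_sub_mem_pow N fun n =>
    Ideal.pow_le_pow_right n.le_succ (key n i)

end Newton

namespace AdicCompletion

variable {P : Type*} [CommRing P] (J : Ideal P)

theorem exists_sub_algebraMap_mem_map_pow (hJ : J.FG) (n : ℕ) (x : AdicCompletion J P) :
    ∃ p : P, x - algebraMap P (AdicCompletion J P) p ∈
      (J.map (algebraMap P (AdicCompletion J P))) ^ n := by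
  obtain ⟨p, hp⟩ := Submodule.Quotient.mk_surjective _ (x.val n)
  refine ⟨p, ?_⟩
  rw [← Ideal.map_pow]
  suffices h : x - of J P p ∈ (J ^ n • ⊤ : Submodule P (AdicCompletion J P)) by
    rwa [Ideal.smul_top_eq_map] at h
  rw [pow_smul_top_eq_ker_eval hJ, LinearMap.mem_ker, map_sub, sub_eq_zero]
  exact hp.symm

theorem map_mkQ_apply_eq_zero_of_mem (K : Ideal P) {x : AdicCompletion J P}
    (hx : x ∈ K.map (algebraMap P (AdicCompletion J P))) : map J K.mkQ x = 0 := by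
  have : K.map (algebraMap P (AdicCompletion J P)) ≤ LinearMap.ker (map J K.mkQ) := by
    refine Ideal.map_le_iff_le_comap.2 fun p hp => ?_
    change map J K.mkQ (of J P p) = 0
    rw [map_of, K.mkQ_apply, (Submodule.Quotient.mk_eq_zero K).2 hp, _root_.map_zero]
  exact this hx

theorem mem_map_of_map_mkQ_apply_eq_zero [IsNoetherianRing P] (K : Ideal P)
    {x : AdicCompletion J P} (hx : map J K.mkQ x = 0) :
    x ∈ K.map (algebraMap P (AdicCompletion J P)) := by
  obtain ⟨y, rfl⟩ := (map_exact (I := J) (f := K.subtype) (g := K.mkQ) K.subtype_injective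
    (LinearMap.exact_subtype_mkQ K) K.mkQ_surjective x).1 hx
  clear hx
  obtain ⟨z, rfl⟩ := ofTensorProduct_surjective_of_finite J K y
  induction z using TensorProduct.induction_on with
  | zero => simp
  | add z w hz hw =>
    rw [map_add, map_add]
    exact add_mem hz hw
  | tmul r k =>
    rw [ofTensorProduct_tmul, map_smul, map_of]
    exact Ideal.mul_mem_left _ _ (Ideal.mem_map_of_mem _ k.2)

/-- A quotient of the completion of a noetherian ring by an ideal extended from that ring is
again complete. -/
theorem isAdicComplete_quotient [IsNoetherianRing P] (K : Ideal P) :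
    IsAdicComplete J (AdicCompletion J P ⧸ K.map (algebraMap P (AdicCompletion J P))) where
  haus' x hx := by
    obtain ⟨x, rfl⟩ := Ideal.Quotient.mk_surjective x
    rw [Ideal.Quotient.eq_zero_iff_mem]
    refine mem_map_of_map_mkQ_apply_eq_zero J K ?_
    ext n
    have hn := hx n
    rw [SModEq.zero, Ideal.smul_top_eq_map, Submodule.restrictScalars_mem,
      show algebraMap P (AdicCompletion J P ⧸ K.map (algebraMap P (AdicCompletion J P))) =
        (Ideal.Quotient.mk _).comp (algebraMap P (AdicCompletion J P)) from rfl, ← Ideal.map_map,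
      Ideal.mem_map_iff_of_surjective _ Ideal.Quotient.mk_surjective] at hn
    obtain ⟨y, hy, hxy⟩ := hn
    have hxy' := map_mkQ_apply_eq_zero_of_mem J K (Ideal.Quotient.eq.1 hxy)
    have hy' : y ∈ (J ^ n • ⊤ : Submodule P (AdicCompletion J P)) := by
      rwa [Ideal.smul_top_eq_map]
    rw [pow_smul_top_eq_ker_eval J.fg_of_isNoetherianRing, LinearMap.mem_ker, eval_apply] at hy'
    rw [map_sub, sub_eq_zero] at hxy'
    rw [← hxy', map_val_apply, hy', _root_.map_zero, val_zero_apply]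
  prec' := by
    have := isAdicComplete (M := P) J.fg_of_isNoetherianRing
    refine (of_surjective_iff.1 fun y => ?_).prec'
    obtain ⟨x, rfl⟩ := map_surjective J (f := (Ideal.Quotient.mkₐ P
      (K.map (algebraMap P (AdicCompletion J P)))).toLinearMap) Ideal.Quotient.mk_surjective y
    obtain ⟨x, rfl⟩ := of_surjective J (AdicCompletion J P) x
    exact ⟨_, (map_of _ _ _).symm⟩

end AdicCompletion

namespace RestrictedPowerSeries

variable {A : Type*} [CommRing A] {I : Ideal A} {m : ℕ} {S : Type*} [CommRing S] (φ : A →+* S)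

/-- A ring homomorphism from the polynomial ring to a complete ring extends to the restricted
power series. -/
theorem exists_lift [IsAdicComplete (I.map φ) S] (f : MvPolynomial (Fin m) A →+* S)
    (hf : ∀ a, f (C a) = φ a) :
    ∃ F : RestrictedPowerSeries A I m →+* S, ∀ p, F (of A I m p) = f p := by
  set J := I.map (algebraMap A (MvPolynomial (Fin m) A))
  have hJ (n : ℕ) : J ^ n ≤ ((I.map φ) ^ n).comap f := by
    rw [← Ideal.map_le_iff_le_comap, Ideal.map_pow, Ideal.map_map]
    rw [show f.comp (algebraMap A (MvPolynomial (Fin m) A)) = φ from RingHom.ext hf]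
  let fn (n : ℕ) : RestrictedPowerSeries A I m →+* S ⧸ (I.map φ) ^ n :=
    (Ideal.quotientMap _ f (hJ n)).comp (AdicCompletion.evalₐ J n).toRingHom
  have hfn_mk (n : ℕ) (x : AdicCompletion.AdicCauchySequence J (MvPolynomial (Fin m) A)) :
      fn n (AdicCompletion.mk J _ x) = Ideal.Quotient.mk _ (f (x.val n)) := by
    change Ideal.quotientMap _ f (hJ n) (AdicCompletion.evalₐ J n
      (AdicCompletion.mk J _ x)) = _
    rw [AdicCompletion.evalₐ_mk, Ideal.quotientMap_mk]
  have hfn {a b : ℕ} (hab : a ≤ b) :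
      (Ideal.Quotient.factorPow (I.map φ) hab).comp (fn b) = fn a := by
    ext x
    induction x using AdicCompletion.induction_on with | _ x
    rw [RingHom.comp_apply, hfn_mk, hfn_mk, ← Ideal.quotientMap_mk (H := hJ a),
      ← AdicCompletion.Ideal.mk_eq_mk J hab x, Ideal.quotientMap_mk]
    rfl
  refine ⟨IsAdicComplete.liftRingHom (I.map φ) fn hfn, fun p => ?_⟩
  refine IsHausdorff.eq_of_sub_mem_pow (I.map φ) fun n => ?_
  rw [← Ideal.Quotient.mk_eq_mk_iff_sub_mem, IsAdicComplete.mk_liftRingHom]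
  change Ideal.quotientMap _ f (hJ n) (AdicCompletion.evalₐ J n (AdicCompletion.of J _ p)) = _
  rw [AdicCompletion.evalₐ_of, Ideal.quotientMap_mk]

/-- Two ring homomorphisms from the restricted power series to a separated ring which agree on
polynomials are equal. -/
theorem ringHom_ext [IsNoetherianRing A] [IsHausdorff (I.map φ) S]
    {F G : RestrictedPowerSeries A I m →+* S}
    (hF : ∀ a, F (of A I m (C a)) = φ a) (h : ∀ p, F (of A I m p) = G (of A I m p)) : F = G := by
  have key (H : RestrictedPowerSeries A I m →+* S) (hH : ∀ a, H (of A I m (C a)) = φ a) (n : ℕ) :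
      ((I.map (algebraMap A (MvPolynomial (Fin m) A))).map (of A I m)) ^ n ≤
        ((I.map φ) ^ n).comap H := by
    rw [← Ideal.map_le_iff_le_comap, Ideal.map_pow, Ideal.map_map, Ideal.map_map]
    rw [show (H.comp (of A I m)).comp (algebraMap A (MvPolynomial (Fin m) A)) = φ from
      RingHom.ext hH]
  ext x
  refine IsHausdorff.eq_of_sub_mem_pow (I.map φ) fun n => ?_
  obtain ⟨p, hp⟩ := AdicCompletion.exists_sub_algebraMap_mem_map_pow
    (I.map (algebraMap A (MvPolynomial (Fin m) A))) (Ideal.fg_of_isNoetherianRing _) n x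
  have h₁ := key F hF n hp
  have h₂ := key G (fun a => by rw [← h, hF]) n hp
  rw [Ideal.mem_comap, map_sub] at h₁ h₂
  convert sub_mem h₁ h₂ using 1
  rw [h p]
  ring

section Quotient

variable (I) (g h : Fin m → MvPolynomial (Fin m) A)

/-- The quotient `A⟨T₁,…,T_m⟩/(g₁,…,g_m)`. -/
noncomputable abbrev QuotientSpan :=
  RestrictedPowerSeries A I m ⧸ Ideal.span (Set.range fun i => of A I m (g i))

/-- The quotient map `A[T₁,…,T_m] → A⟨T₁,…,T_m⟩/(g₁,…,g_m)`. -/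
noncomputable abbrev toQuotient : MvPolynomial (Fin m) A →+* QuotientSpan I g :=
  (Ideal.Quotient.mk _).comp (of A I m)

theorem toQuotient_self (i : Fin m) : toQuotient I g (g i) = 0 :=
  Ideal.Quotient.eq_zero_iff_mem.2 (Ideal.subset_span ⟨i, rfl⟩)

theorem isAdicComplete_quotientSpan [IsNoetherianRing A] :
    IsAdicComplete (I.map (algebraMap A (QuotientSpan I g))) (QuotientSpan I g) := by
  have h : IsAdicComplete (I.map (algebraMap A (MvPolynomial (Fin m) A))) (QuotientSpan I g) := by
    have h := AdicCompletion.isAdicComplete_quotient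
      (I.map (algebraMap A (MvPolynomial (Fin m) A))) (Ideal.span (Set.range g))
    rwa [Ideal.map_span, ← Set.range_comp] at h
  have h' := (IsAdicComplete.map_algebraMap_iff (S := QuotientSpan I g) _ _).2 h
  rwa [Ideal.map_map] at h'

variable {I g h}

theorem toQuotient_mem_of_mem {p : MvPolynomial (Fin m) A}
    (hp : p ∈ I.map (algebraMap A (MvPolynomial (Fin m) A))) :
    toQuotient I g p ∈ I.map (algebraMap A (QuotientSpan I g)) := by
  have := Ideal.mem_map_of_mem (toQuotient I g) hp
  rwa [Ideal.map_map] at this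

theorem aeval_eq_of_forall {S : Type*} [CommRing S] [Algebra A S]
    (f : MvPolynomial (Fin m) A →+* S) (hf : ∀ a, f (C a) = algebraMap A S a)
    (p : MvPolynomial (Fin m) A) : aeval (fun i => f (X i)) p = f p := by
  refine RingHom.congr_fun (f := (aeval fun i => f (X i)).toRingHom) ?_ p
  refine MvPolynomial.ringHom_ext (fun a => ?_) fun i => ?_
  · simp [hf]
  · simp

theorem aeval_toQuotient (p : MvPolynomial (Fin m) A) :
    aeval (fun i => toQuotient I g (X i)) p = toQuotient I g p :=
  aeval_eq_of_forall (toQuotient I g) (fun _ => rfl) p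

theorem isUnit_toQuotient_of_isUnit [IsNoetherianRing A]
    (hgh : ∀ i, g i - h i ∈ I.map (algebraMap A (MvPolynomial (Fin m) A)))
    {p : MvPolynomial (Fin m) A} (hp : IsUnit (toQuotient I g p)) :
    IsUnit (toQuotient I h p) := by
  have := isAdicComplete_quotientSpan I h
  obtain ⟨b, hb⟩ := hp.exists_right_inv
  obtain ⟨b, rfl⟩ := Ideal.Quotient.mk_surjective b
  have hle : Ideal.span (Set.range fun i => of A I m (g i)) ≤
      (I.map (algebraMap A (QuotientSpan I h))).comap (Ideal.Quotient.mk _) := by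
    rw [Ideal.span_le]
    rintro _ ⟨i, rfl⟩
    have := toQuotient_mem_of_mem (g := h) (hgh i)
    rwa [map_sub, toQuotient_self, sub_zero] at this
  have hmem : of A I m p * b - 1 ∈ Ideal.span (Set.range fun i => of A I m (g i)) := by
    rw [← Ideal.Quotient.eq, map_mul, map_one]
    exact hb
  have := hle hmem
  rw [Ideal.mem_comap, map_sub, map_one, map_mul] at this
  exact isUnit_of_mul_isUnit_left (IsAdicComplete.isUnit_of_sub_mem _ isUnit_one this)

/-- If `g` and `h` are congruent modulo `I` and `Δ` is invertible in the quotient by `h`, then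
there is a homomorphism between the quotients which is congruent to the identity. -/
theorem exists_hom_quotientSpan [IsNoetherianRing A]
    (hgh : ∀ i, g i - h i ∈ I.map (algebraMap A (MvPolynomial (Fin m) A)))
    (hΔ : IsUnit (toQuotient I h (jacobianDet g))) :
    ∃ φ : QuotientSpan I g →+* QuotientSpan I h,
      (∀ a, φ (algebraMap A _ a) = algebraMap A _ a) ∧
      ∀ i, φ (toQuotient I g (X i)) - toQuotient I h (X i) ∈
        I.map (algebraMap A (QuotientSpan I h)) := by
  have := isAdicComplete_quotientSpan I h
  obtain ⟨t, ht, ht'⟩ := exists_aeval_eq_zero_of_isUnit_jacobianDet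
    (I.map (algebraMap A (QuotientSpan I h))) g (t := fun i => toQuotient I h (X i))
    (by rwa [aeval_toQuotient]) (fun i => by
      have := toQuotient_mem_of_mem (g := h) (hgh i)
      rwa [map_sub, toQuotient_self, sub_zero, ← aeval_toQuotient] at this)
  obtain ⟨F, hF⟩ := exists_lift (I := I) (algebraMap A (QuotientSpan I h)) (aeval t).toRingHom
    (fun a => (aeval t).commutes a)
  have hF0 : ∀ x ∈ Ideal.span (Set.range fun i => of A I m (g i)), F x = 0 := by
    intro x hx
    have hle : Ideal.span (Set.range fun i => of A I m (g i)) ≤ RingHom.ker F := by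
      rw [Ideal.span_le]
      rintro _ ⟨i, rfl⟩
      exact (hF _).trans (ht' i)
    exact hle hx
  refine ⟨Ideal.Quotient.lift _ F hF0, fun a => ?_, fun i => ?_⟩
  · exact (hF (C a)).trans ((aeval t).commutes a)
  · have : Ideal.Quotient.lift _ F hF0 (toQuotient I g (X i)) = t i :=
      (hF (X i)).trans (aeval_X t i)
    rw [this]
    exact ht i

theorem eq_id_of_sub_mem [IsNoetherianRing A] (hΔ : IsUnit (toQuotient I g (jacobianDet g)))
    {φ : QuotientSpan I g →+* QuotientSpan I g}
    (hφ : ∀ a, φ (algebraMap A _ a) = algebraMap A _ a)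
    (hφX : ∀ i, φ (toQuotient I g (X i)) - toQuotient I g (X i) ∈
      I.map (algebraMap A (QuotientSpan I g))) : φ = RingHom.id _ := by
  have := isAdicComplete_quotientSpan I g
  have haeval (p : MvPolynomial (Fin m) A) :
      aeval (fun i => φ (toQuotient I g (X i))) p = φ (toQuotient I g p) :=
    aeval_eq_of_forall (φ.comp (toQuotient I g)) hφ p
  have ht : (fun i => φ (toQuotient I g (X i))) = fun i => toQuotient I g (X i) :=
    eq_of_aeval_eq_zero_of_isUnit_jacobianDet (I.map (algebraMap A (QuotientSpan I g))) g
      (by rwa [aeval_toQuotient]) (fun i => by rw [aeval_toQuotient, toQuotient_self])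
      (fun i => by rw [haeval, toQuotient_self, map_zero]) hφX
  refine Ideal.Quotient.ringHom_ext (ringHom_ext (algebraMap A (QuotientSpan I g)) hφ fun p => ?_)
  change φ (toQuotient I g p) = toQuotient I g p
  rw [← haeval, ht, aeval_toQuotient]

/-- The composition of two homomorphisms congruent to the identity is the identity. -/
theorem comp_eq_id_of_sub_mem [IsNoetherianRing A] (hΔ : IsUnit (toQuotient I g (jacobianDet g)))
    {φ : QuotientSpan I g →+* QuotientSpan I h} {ψ : QuotientSpan I h →+* QuotientSpan I g}
    (hφ : ∀ a, φ (algebraMap A _ a) = algebraMap A _ a)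
    (hφX : ∀ i, φ (toQuotient I g (X i)) - toQuotient I h (X i) ∈
      I.map (algebraMap A (QuotientSpan I h)))
    (hψ : ∀ a, ψ (algebraMap A _ a) = algebraMap A _ a)
    (hψX : ∀ i, ψ (toQuotient I h (X i)) - toQuotient I g (X i) ∈
      I.map (algebraMap A (QuotientSpan I g))) : ψ.comp φ = RingHom.id _ := by
  refine eq_id_of_sub_mem hΔ (fun a => by rw [RingHom.comp_apply, hφ, hψ]) fun i => ?_
  rw [RingHom.comp_apply, ← sub_add_sub_cancel _ (ψ (toQuotient I h (X i))), ← map_sub]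
  refine add_mem ?_ (hψX i)
  have := Ideal.mem_map_of_mem ψ (hφX i)
  rwa [Ideal.map_map, show ψ.comp (algebraMap A (QuotientSpan I h)) = algebraMap A _ from
    RingHom.ext hψ] at this

theorem mem_of_of_mem {p : MvPolynomial (Fin m) A}
    (hp : of A I m p ∈ I.map ((of A I m).comp (algebraMap A (MvPolynomial (Fin m) A)))) :
    p ∈ I.map (algebraMap A (MvPolynomial (Fin m) A)) := by
  have h := Ideal.mem_map_of_mem
    (AdicCompletion.evalOneₐ (I.map (algebraMap A (MvPolynomial (Fin m) A)))).toRingHom hp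
  rw [← Ideal.map_map, Ideal.map_map, show RingHom.comp
    (AdicCompletion.evalOneₐ (I.map (algebraMap A (MvPolynomial (Fin m) A)))).toRingHom
    (of A I m) = Ideal.Quotient.mk _ from rfl, Ideal.map_quotient_self, Ideal.mem_bot] at h
  exact Ideal.Quotient.eq_zero_iff_mem.1 h

end Quotient

end RestrictedPowerSeries

theorem MvPolynomial.pderiv_mem_map_algebraMap {A σ : Type*} [CommRing A] (I : Ideal A) (i : σ)
    {p : MvPolynomial σ A} (hp : p ∈ I.map (algebraMap A (MvPolynomial σ A))) :
    pderiv i p ∈ I.map (algebraMap A (MvPolynomial σ A)) := by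
  induction hp using Submodule.span_induction with
  | mem x hx =>
    obtain ⟨a, -, rfl⟩ := hx
    simp
  | zero => simp
  | add x y _ _ hx hy => simpa using add_mem hx hy
  | smul a x hx hx' =>
    rw [smul_eq_mul, pderiv_mul]
    exact add_mem (Ideal.mul_mem_left _ _ hx) (Ideal.mul_mem_left _ _ hx')

theorem jacobianDet_sub_mem {A : Type*} [CommRing A] (I : Ideal A) {m : ℕ}
    {g h : Fin m → MvPolynomial (Fin m) A}
    (hgh : ∀ i, g i - h i ∈ I.map (algebraMap A (MvPolynomial (Fin m) A))) :
    jacobianDet g - jacobianDet h ∈ I.map (algebraMap A (MvPolynomial (Fin m) A)) := by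
  rw [← Ideal.Quotient.mk_eq_mk_iff_sub_mem, jacobianDet, jacobianDet, RingHom.map_det,
    RingHom.map_det]
  congr 1
  ext i j
  simp only [RingHom.mapMatrix_apply, Matrix.map_apply, Matrix.of_apply]
  rw [Ideal.Quotient.mk_eq_mk_iff_sub_mem, ← map_sub]
  exact pderiv_mem_map_algebraMap I j (hgh i)

/-- If `g₁,…,g_m` and `h₁,…,h_m` are polynomials with `gᵢ − hᵢ ∈ I·A⟨T⟩` and the Jacobian
determinant `det(∂gᵢ/∂Tⱼ)` is invertible in `B = A⟨T⟩/(g₁,…,g_m)`, then `B` and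
`B′ = A⟨T⟩/(h₁,…,h_m)` are isomorphic as `A`-algebras. -/
theorem statement1 {A : Type*} [CommRing A] [IsNoetherianRing A] (I : Ideal A)
    [IsAdicComplete I A] (m : ℕ) (g h : Fin m → MvPolynomial (Fin m) A)
    (hgh : ∀ i : Fin m, RestrictedPowerSeries.of A I m (g i - h i) ∈
      I.map ((RestrictedPowerSeries.of A I m).comp (algebraMap A (MvPolynomial (Fin m) A))))
    (hΔ : IsUnit
      (Ideal.Quotient.mk (Ideal.span (Set.range fun i => RestrictedPowerSeries.of A I m (g i)))
        (RestrictedPowerSeries.of A I m (jacobianDet g)))) :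
    ∃ e : (RestrictedPowerSeries A I m ⧸
            Ideal.span (Set.range fun i => RestrictedPowerSeries.of A I m (g i))) ≃+*
          (RestrictedPowerSeries A I m ⧸
            Ideal.span (Set.range fun i => RestrictedPowerSeries.of A I m (h i))),
      ∀ a : A,
        e (Ideal.Quotient.mk _ (RestrictedPowerSeries.of A I m (C a))) =
          Ideal.Quotient.mk _ (RestrictedPowerSeries.of A I m (C a)) := by
  have hgh' (i : Fin m) := RestrictedPowerSeries.mem_of_of_mem (hgh i)
  have hhg (i : Fin m) : h i - g i ∈ I.map (algebraMap A (MvPolynomial (Fin m) A)) := by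
    rw [← neg_sub]
    exact neg_mem (hgh' i)
  have hΔ' : IsUnit (RestrictedPowerSeries.toQuotient I h (jacobianDet g)) :=
    RestrictedPowerSeries.isUnit_toQuotient_of_isUnit hgh' hΔ
  have hΔg : IsUnit (RestrictedPowerSeries.toQuotient I g (jacobianDet h)) := by
    have := RestrictedPowerSeries.isAdicComplete_quotientSpan I g
    refine IsAdicComplete.isUnit_of_sub_mem
      (I.map (algebraMap A (RestrictedPowerSeries.QuotientSpan I g))) hΔ ?_
    exact RestrictedPowerSeries.toQuotient_mem_of_mem (g := g) (jacobianDet_sub_mem I hhg)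
  have hΔh : IsUnit (RestrictedPowerSeries.toQuotient I h (jacobianDet h)) :=
    RestrictedPowerSeries.isUnit_toQuotient_of_isUnit hgh' hΔg
  obtain ⟨φ, hφ, hφX⟩ := RestrictedPowerSeries.exists_hom_quotientSpan hgh' hΔ'
  obtain ⟨ψ, hψ, hψX⟩ := RestrictedPowerSeries.exists_hom_quotientSpan hhg hΔg
  exact ⟨RingEquiv.ofRingHom φ ψ (RestrictedPowerSeries.comp_eq_id_of_sub_mem hΔh hψ hψX hφ hφX)
    (RestrictedPowerSeries.comp_eq_id_of_sub_mem hΔ hφ hφX hψ hψX), hφ⟩
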